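/- Let a_0 ≥ 1 and a_1,…,a_n ≥ 2 be integers (n ≥ 1), let c ∈ ℂ be nonzero, and set d := a_1a_2⋯a_n, μ := μ(a_2,…,a_n), and F(z_0,z_1) := z_1^d − c·(z_0^{a_0}z_1 − 1)^μ. Let B := {(z_0,z_1) ∈ ℂ² : F(z_0,z_1) = 0 and ∂F/∂z_1(z_0,z_1) = 0} be the set of branch points of the projection of the curve {F = 0} to the z_0-coordinate. Then every point of B satisfies μ(a_1,…,a_n)·z_0^{a_0}·z_1 = d (note d − μ = μ(a_1,…,a_n) ≥ 1), B has exactly a_0·d elements, and there exists C ∈ ℂ* such that z_0^{a_0·d} = C for every (z_0,z_1) ∈ B. -/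

import Mathlib

open MvPolynomial

/-- The Milnor number of the chain type singularity associated to the tuple
`a = (a_1, …, a_n)`, with `μ(∅) = 1`. -/
def chainMu (a : List ℕ) : ℤ :=
  ∑ k ∈ Finset.range (a.length + 1), (-1 : ℤ) ^ k * ((a.drop k).prod : ℤ)

/-- The plane curve polynomial `F(z_0, z_1) = z_1^d − c (z_0^{a_0} z_1 − 1)^μ`
in two variables. -/
noncomputable def planeF (a0 d m : ℕ) (c : ℂ) : MvPolynomial (Fin 2) ℂ :=
  X 1 ^ d - C c * (X 0 ^ a0 * X 1 - 1) ^ m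

/-- The branch points of the projection of `{F = 0}` to the `z_0`-coordinate:
points where `F = 0` and `∂F/∂z_1 = 0`. -/
def branchSet (a0 d m : ℕ) (c : ℂ) : Set (Fin 2 → ℂ) :=
  {z | eval z (planeF a0 d m c) = 0 ∧ eval z (pderiv 1 (planeF a0 d m c)) = 0}

lemma chainMu_cons (x : ℕ) (t : List ℕ) :
    chainMu (x :: t) = ((x :: t).prod : ℤ) - chainMu t := by
  unfold chainMu
  rw [List.length_cons, Finset.sum_range_succ']
  simp [pow_succ]
  ring

lemma one_le_chainMu_and_le_prod (a : List ℕ) (h2 : ∀ x ∈ a, 2 ≤ x) :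
    1 ≤ chainMu a ∧ chainMu a ≤ (a.prod : ℤ) := by
  induction a with
  | nil => simp [chainMu]
  | cons x t ih =>
    obtain ⟨h1, h3⟩ := ih fun y hy => h2 y (List.mem_cons_of_mem _ hy)
    have hx : (2 : ℤ) ≤ x := by exact_mod_cast h2 x List.mem_cons_self
    rw [chainMu_cons, List.prod_cons]
    push_cast at *
    constructor <;> nlinarith

lemma mem_branchSet_iff_eqs (a0 d m : ℕ) (c : ℂ) (z : Fin 2 → ℂ) :
    z ∈ branchSet a0 d m c ↔ z 1 ^ d = c * (z 0 ^ a0 * z 1 - 1) ^ m ∧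
      d * z 1 ^ (d - 1) = c * (m * (z 0 ^ a0 * z 1 - 1) ^ (m - 1) * z 0 ^ a0) := by
  simp [branchSet, planeF, Derivation.leibniz_pow, Derivation.leibniz, pderiv_X, sub_eq_zero,
    mul_assoc]

lemma mem_branchSet_iff {a0 d m : ℕ} {c : ℂ} (hm : 1 ≤ m) (hd : m < d) (hc : c ≠ 0)
    (z : Fin 2 → ℂ) :
    z ∈ branchSet a0 d m c ↔ ((d : ℂ) - m) * (z 0 ^ a0 * z 1) = d ∧
      z 1 ^ d = c * (m / ((d : ℂ) - m)) ^ m := by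
  have hdC : (d : ℂ) ≠ 0 := by exact_mod_cast (by omega : d ≠ 0)
  have he : (d : ℂ) - m ≠ 0 := sub_ne_zero.2 (by exact_mod_cast hd.ne')
  have hw : ∀ w : ℂ, ((d : ℂ) - m) * w = d → w - 1 = m / ((d : ℂ) - m) := by
    intro w h
    rw [eq_div_iff he]
    linear_combination h
  rw [mem_branchSet_iff_eqs]
  generalize z 0 ^ a0 = u
  generalize z 1 = y
  have hyd : y ^ (d - 1) * y = y ^ d := pow_sub_one_mul (by omega) y
  have hwm : (u * y - 1) ^ (m - 1) * (u * y - 1) = (u * y - 1) ^ m :=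
    pow_sub_one_mul (by omega) _
  constructor
  · rintro ⟨hF, hF'⟩
    have hw1 : u * y - 1 ≠ 0 := by
      intro h
      rw [h, zero_pow (by omega), mul_zero] at hF
      have hy : y = 0 := pow_eq_zero_iff (by omega) |>.1 hF
      simp [hy] at h
    have key : ((d : ℂ) - m) * (u * y) = d := by
      have h : c * (u * y - 1) ^ (m - 1) * (((d : ℂ) - m) * (u * y) - d) = 0 := by
        linear_combination y * hF' - d * hF - d * hyd + d * c * hwm
      exact sub_eq_zero.1 ((mul_eq_zero.1 h).resolve_left
        (mul_ne_zero hc (pow_ne_zero _ hw1)))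
    exact ⟨key, by rw [hF, hw _ key]⟩
  · rintro ⟨key, hK⟩
    have hF : y ^ d = c * (u * y - 1) ^ m := by rw [hK, hw _ key]
    refine ⟨hF, ?_⟩
    have hy : y ≠ 0 := by
      rintro rfl
      exact hdC (by simpa using key.symm)
    refine mul_right_cancel₀ hy ?_
    linear_combination d * hF + d * hyd - d * c * hwm + c * (u * y - 1) ^ (m - 1) * key

lemma ncard_setOf_pow_eq {n : ℕ} (hn : n ≠ 0) {b : ℂ} (hb : b ≠ 0) :
    {x : ℂ | x ^ n = b}.ncard = n := by
  have hζ := Complex.isPrimitiveRoot_exp n hn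
  obtain ⟨α, hα⟩ := IsAlgClosed.exists_pow_nat_eq b (Nat.pos_of_ne_zero hn)
  classical
  have hset : {x : ℂ | x ^ n = b} = (Polynomial.nthRoots n b).toFinset := by
    ext x
    simp [Polynomial.mem_nthRoots (Nat.pos_of_ne_zero hn)]
  rw [hset, Set.ncard_coe_finset,
    Multiset.toFinset_card_of_nodup (hζ.nthRoots_nodup hb), hζ.card_nthRoots, if_pos ⟨α, hα⟩]

lemma mem_branchSet_iff_pow {a0 d m : ℕ} {c : ℂ} (hm : 1 ≤ m) (hd : m < d)
    (hc : c ≠ 0) (z : Fin 2 → ℂ) :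
    z ∈ branchSet a0 d m c ↔
      z 0 ^ (a0 * d) = (d / ((d : ℂ) - m)) ^ d / (c * (m / ((d : ℂ) - m)) ^ m) ∧
      z 1 = d / ((d : ℂ) - m) / z 0 ^ a0 := by
  have hmC : (m : ℂ) ≠ 0 := by exact_mod_cast (by omega : m ≠ 0)
  have hdC : (d : ℂ) ≠ 0 := by exact_mod_cast (by omega : d ≠ 0)
  have he : (d : ℂ) - m ≠ 0 := sub_ne_zero.2 (by exact_mod_cast hd.ne')
  have hw : (d : ℂ) / (d - m) ≠ 0 := div_ne_zero hdC he
  have hK : c * (m / ((d : ℂ) - m)) ^ m ≠ 0 :=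
    mul_ne_zero hc (pow_ne_zero _ (div_ne_zero hmC he))
  rw [mem_branchSet_iff hm hd hc, mul_comm, ← eq_div_iff he, pow_mul]
  generalize (d : ℂ) / (d - m) = w at *
  generalize c * (m / ((d : ℂ) - m)) ^ m = K at *
  generalize z 0 ^ a0 = u
  constructor
  · rintro ⟨rfl, rfl⟩
    have hu : u ≠ 0 := left_ne_zero_of_mul hw
    exact ⟨by rw [mul_pow, mul_div_cancel_right₀ _ hK], (mul_div_cancel_left₀ _ hu).symm⟩
  · rintro ⟨h, hy⟩
    have hu : u ≠ 0 := by
      rintro rfl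
      rw [zero_pow (by omega)] at h
      exact div_ne_zero (pow_ne_zero _ hw) hK h.symm
    refine ⟨by rw [hy, mul_div_cancel₀ _ hu], ?_⟩
    rw [hy, div_pow, h, div_div_cancel₀ (pow_ne_zero _ hw)]

lemma ncard_branchSet {a0 d m : ℕ} {c : ℂ} (h0 : 1 ≤ a0) (hm : 1 ≤ m) (hd : m < d)
    (hc : c ≠ 0) : (branchSet a0 d m c).ncard = a0 * d := by
  have hmC : (m : ℂ) ≠ 0 := by exact_mod_cast (by omega : m ≠ 0)
  have hdC : (d : ℂ) ≠ 0 := by exact_mod_cast (by omega : d ≠ 0)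
  have he : (d : ℂ) - m ≠ 0 := sub_ne_zero.2 (by exact_mod_cast hd.ne')
  have hC : (d / ((d : ℂ) - m)) ^ d / (c * (m / ((d : ℂ) - m)) ^ m) ≠ 0 := by positivity
  have hN : a0 * d ≠ 0 := Nat.mul_ne_zero (by omega) (by omega)
  have himage : branchSet a0 d m c = (fun x : ℂ => ![x, d / ((d : ℂ) - m) / x ^ a0]) ''
      {x : ℂ | x ^ (a0 * d) = (d / ((d : ℂ) - m)) ^ d / (c * (m / ((d : ℂ) - m)) ^ m)} := by
    ext z
    rw [mem_branchSet_iff_pow hm hd hc]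
    constructor
    · rintro ⟨h, hy⟩
      refine ⟨z 0, h, ?_⟩
      ext i
      fin_cases i <;> simp [hy]
    · rintro ⟨x, hx, rfl⟩
      exact ⟨hx, rfl⟩
  rw [himage, Set.ncard_image_of_injective _ fun x y h => by simpa using congrFun h 0,
    ncard_setOf_pow_eq hN hC]

/-- Let `a_0 ≥ 1`, `a_1,…,a_n ≥ 2` (`n ≥ 1`), `c ≠ 0`, `d = a_1⋯a_n`,
`μ = μ(a_2,…,a_n)`, `F = z_1^d − c (z_0^{a_0} z_1 − 1)^μ`, and let `B` be the set
of branch points of the projection of `{F = 0}` to `z_0`.  Then every point of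
`B` satisfies `μ(a_1,…,a_n) z_0^{a_0} z_1 = d`, `B` has exactly `a_0 d` elements,
and there is `C ∈ ℂ*` with `z_0^{a_0 d} = C` for all `(z_0, z_1) ∈ B`. -/
theorem stmt19 (a0 : ℕ) (h0 : 1 ≤ a0) (a : List ℕ) (hne : a ≠ [])
    (h2 : ∀ x ∈ a, 2 ≤ x) (c : ℂ) (hc : c ≠ 0)
    (m : ℕ) (hm : (m : ℤ) = chainMu a.tail) :
    (∀ z ∈ branchSet a0 a.prod m c,
      (chainMu a : ℂ) * (z 0 ^ a0 * z 1) = (a.prod : ℂ)) ∧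
    (branchSet a0 a.prod m c).ncard = a0 * a.prod ∧
    ∃ C : ℂ, C ≠ 0 ∧ ∀ z ∈ branchSet a0 a.prod m c, z 0 ^ (a0 * a.prod) = C := by
  obtain ⟨x, t, rfl⟩ := List.exists_cons_of_ne_nil hne
  have ht : ∀ y ∈ t, 2 ≤ y := fun y hy => h2 y (List.mem_cons_of_mem _ hy)
  obtain ⟨h1, -⟩ := one_le_chainMu_and_le_prod t ht
  obtain ⟨h3, -⟩ := one_le_chainMu_and_le_prod (x :: t) h2
  rw [List.tail_cons] at hm
  have hmu : chainMu (x :: t) = ((x :: t).prod : ℤ) - m := by rw [chainMu_cons, hm]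
  generalize (x :: t).prod = d at *
  have hm1 : 1 ≤ m := by omega
  have hd : m < d := by omega
  have hmC : (m : ℂ) ≠ 0 := by exact_mod_cast (by omega : m ≠ 0)
  have hdC : (d : ℂ) ≠ 0 := by exact_mod_cast (by omega : d ≠ 0)
  have he : (d : ℂ) - m ≠ 0 := sub_ne_zero.2 (by exact_mod_cast hd.ne')
  refine ⟨fun z hz => ?_, ncard_branchSet h0 hm1 hd hc,
    (d / ((d : ℂ) - m)) ^ d / (c * (m / ((d : ℂ) - m)) ^ m), by positivity,
    fun z hz => ((mem_branchSet_iff_pow hm1 hd hc z).1 hz).1⟩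
  rw [hmu]
  push_cast
  exact ((mem_branchSet_iff hm1 hd hc z).1 hz).1
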